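/- For c > 0, t ≥ 0, and any integer k ≥ 2, the tail of Chebyshev coefficients of g(x) = (1 − e^{−ct} e^{−ctx})/(c(x+1)) satisfies Σ_{m=k−1}^{∞} |a_m[g]| ≤ (2 e^{−ct}/c) Σ_{ν=k}^{∞} (ν−k+2)(ν−k+1) I_ν(ct). -/

import Mathlib

open Real

/-- Modified Bessel function of the first kind of integer order:
`I_ν(w) = (1/π) ∫_0^π e^{w cos θ} cos(ν θ) dθ`. -/
noncomputable def besselI (ν : ℕ) (w : ℝ) : ℝ :=
  (1 / Real.pi) * ∫ θ in (0:ℝ)..Real.pi, Real.exp (w * Real.cos θ) * Real.cos (ν * θ)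

/-- The `m`-th Chebyshev coefficient `a_m[h] = (2/π)∫_{−1}^1 h(x) T_m(x)/√(1−x²) dx`. -/
noncomputable def chebCoeff (h : ℝ → ℝ) (m : ℕ) : ℝ :=
  (2 / Real.pi) *
    ∫ x in (-1:ℝ)..1, h x * (Polynomial.Chebyshev.T ℝ m).eval x / Real.sqrt (1 - x ^ 2)

open Filter Topology in
/-- If a null sequence has nonnegative and geometrically bounded decrements, then it is itself
nonnegative and geometrically bounded. -/
theorem bounds_of_sub_succ_bounds {f : ℕ → ℝ} {C : ℝ} (hf : Tendsto f atTop (𝓝 0))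
    (h : ∀ m, 0 ≤ f m - f (m + 1) ∧ f m - f (m + 1) ≤ C * (1 / 2) ^ m) (m : ℕ) :
    0 ≤ f m ∧ f m ≤ 2 * C * (1 / 2) ^ m := by
  have hgeom : Tendsto (fun m : ℕ => ((1 : ℝ) / 2) ^ m) atTop (𝓝 0) :=
    tendsto_pow_atTop_nhds_zero_of_lt_one (by norm_num) (by norm_num)
  constructor
  · exact (antitone_nat_of_succ_le fun n => by linarith [(h n).1]).le_of_tendsto hf m
  · have hmono : Monotone fun m : ℕ => f m - 2 * C * (1 / 2) ^ m :=
      monotone_nat_of_le_succ fun n => by rw [pow_succ]; linarith [(h n).2]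
    have hlim : Tendsto (fun m : ℕ => f m - 2 * C * (1 / 2) ^ m) atTop (𝓝 0) := by
      simpa using hf.sub (hgeom.const_mul (2 * C))
    linarith [hmono.ge_of_tendsto hlim m]

theorem sum_range_weighted_second_difference (u : ℕ → ℝ) (N : ℕ) :
    ∑ i ∈ Finset.range N, ((i : ℝ) + 2) * ((i : ℝ) + 1) * (u i - 2 * u (i + 1) + u (i + 2)) =
      2 * ∑ i ∈ Finset.range N, u i - 2 * N * u N - N * (N + 1) * (u N - u (N + 1)) := by
  induction N with
  | zero => simp
  | succ n ih =>
    rw [Finset.sum_range_succ, Finset.sum_range_succ, ih]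
    push_cast
    ring

open Filter Topology in
theorem tsum_weighted_second_difference {u : ℕ → ℝ} {C D : ℝ}
    (hu : ∀ m, 0 ≤ u m ∧ u m ≤ C * (1 / 2) ^ m)
    (hd : ∀ m, 0 ≤ u m - 2 * u (m + 1) + u (m + 2) ∧
      u m - 2 * u (m + 1) + u (m + 2) ≤ D * (1 / 2) ^ m) :
    ∑' i : ℕ, ((i : ℝ) + 2) * ((i : ℝ) + 1) * (u i - 2 * u (i + 1) + u (i + 2)) =
      2 * ∑' i : ℕ, u i := by
  have hg (k : ℕ) : Summable fun n : ℕ => (n : ℝ) ^ k * ((1 : ℝ) / 2) ^ n :=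
    summable_pow_mul_geometric_of_norm_lt_one k (by norm_num)
  have hu_sum : Summable u := by
    refine Summable.of_nonneg_of_le (fun m => (hu m).1) (fun m => (hu m).2) ?_
    simpa using (hg 0).mul_left C
  have hd_sum : Summable fun i : ℕ =>
      ((i : ℝ) + 2) * ((i : ℝ) + 1) * (u i - 2 * u (i + 1) + u (i + 2)) := by
    refine Summable.of_nonneg_of_le (fun m => mul_nonneg (by positivity) (hd m).1)
      (fun m => mul_le_mul_of_nonneg_left (hd m).2 (by positivity)) ?_
    refine ((((hg 2).add ((hg 1).mul_left 3)).add ((hg 0).mul_left 2)).mul_left D).congr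
      fun m => ?_
    ring
  have hpoly (k : ℕ) : Tendsto (fun n : ℕ => (n : ℝ) ^ k * u n) atTop (𝓝 0) := by
    refine squeeze_zero (fun n => mul_nonneg (by positivity) (hu n).1)
      (fun n => mul_le_mul_of_nonneg_left (hu n).2 (by positivity)) ?_
    have := (hg k).tendsto_atTop_zero.const_mul C
    rw [mul_zero] at this
    refine this.congr fun n => ?_
    ring
  have hpoly' (k : ℕ) : Tendsto (fun n : ℕ => ((n : ℝ) + 1) ^ k * u (n + 1)) atTop (𝓝 0) := by
    simpa [Function.comp_def] using (hpoly k).comp (tendsto_add_atTop_nat 1)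
  have hlim : Tendsto (fun N : ℕ =>
      2 * ∑ i ∈ Finset.range N, u i - 2 * N * u N - N * (N + 1) * (u N - u (N + 1)))
      atTop (𝓝 (2 * ∑' i : ℕ, u i)) := by
    have := (((((hu_sum.hasSum.tendsto_sum_nat.const_mul 2).sub ((hpoly 1).const_mul 2)).sub
      (hpoly 2)).sub (hpoly 1)).add (hpoly' 2)).sub (hpoly' 1)
    simp only [mul_zero, sub_zero, add_zero] at this
    refine this.congr fun n => ?_
    ring
  refine tendsto_nhds_unique ?_ hlim
  exact hd_sum.hasSum.tendsto_sum_nat.congr fun N => sum_range_weighted_second_difference u N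

theorem integral_cos_pow_mul_cos_bounds (n ν : ℕ) :
    0 ≤ (∫ θ in (0 : ℝ)..π, cos θ ^ n * cos (ν * θ)) ∧
      (∫ θ in (0 : ℝ)..π, cos θ ^ n * cos (ν * θ)) ≤ π * 2 ^ n * (1 / 2) ^ ν := by
  induction n generalizing ν with
  | zero =>
    rcases eq_or_ne ν 0 with rfl | hν
    · simp [pi_pos.le]
    · have hν' : (ν : ℝ) ≠ 0 := by exact_mod_cast hν
      have : (∫ θ in (0 : ℝ)..π, cos θ ^ 0 * cos (ν * θ)) = 0 := by
        simp [intervalIntegral.integral_comp_mul_left (fun x => cos x) hν', sin_nat_mul_pi]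
      rw [this]
      exact ⟨le_rfl, by positivity⟩
  | succ n ih =>
    cases ν with
    | zero =>
      have h := ih 1
      have heq : (∫ θ in (0 : ℝ)..π, cos θ ^ (n + 1) * cos ((0 : ℕ) * θ)) =
          ∫ θ in (0 : ℝ)..π, cos θ ^ n * cos ((1 : ℕ) * θ) := by
        simp [pow_succ]
      rw [heq]
      refine ⟨h.1, h.2.trans ?_⟩
      have : 0 < π * 2 ^ n := by positivity
      rw [pow_succ 2 n, pow_zero, pow_one]
      linarith
    | succ ν =>
      have h₁ := ih (ν + 2)
      have h₂ := ih ν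
      have heq : (∫ θ in (0 : ℝ)..π, cos θ ^ (n + 1) * cos ((ν + 1 : ℕ) * θ)) =
          (1 / 2) * ((∫ θ in (0 : ℝ)..π, cos θ ^ n * cos ((ν + 2 : ℕ) * θ)) +
            ∫ θ in (0 : ℝ)..π, cos θ ^ n * cos (ν * θ)) := by
        rw [← intervalIntegral.integral_add
          (Continuous.intervalIntegrable (by fun_prop) _ _)
          (Continuous.intervalIntegrable (by fun_prop) _ _),
          ← intervalIntegral.integral_const_mul]
        congr 1 with θ
        have e₁ : ((ν + 2 : ℕ) : ℝ) * θ = (ν + 1 : ℕ) * θ + θ := by push_cast; ring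
        have e₂ : (ν : ℝ) * θ = (ν + 1 : ℕ) * θ - θ := by push_cast; ring
        rw [e₁, e₂, cos_add, cos_sub]
        ring
      rw [heq]
      refine ⟨by linarith [h₁.1, h₂.1], ?_⟩
      have : 0 < π * 2 ^ n * (1 / 2) ^ ν := by positivity
      rw [pow_succ, pow_succ]
      have h₃ := h₁.2
      rw [pow_add] at h₃
      linarith [h₂.2]

theorem hasSum_integral_exp_mul_cos (ν : ℕ) (w : ℝ) :
    HasSum (fun n : ℕ => w ^ n / n.factorial * ∫ θ in (0 : ℝ)..π, cos θ ^ n * cos (ν * θ))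
      (∫ θ in (0 : ℝ)..π, exp (w * cos θ) * cos (ν * θ)) := by
  simp_rw [← intervalIntegral.integral_const_mul]
  refine intervalIntegral.hasSum_integral_of_dominated_convergence
    (fun n _ => |w| ^ n / n.factorial)
    (fun n => (Continuous.aestronglyMeasurable (by fun_prop)))
    (fun n => .of_forall fun θ _ => ?_)
    (.of_forall fun θ _ => summable_pow_div_factorial |w|)
    intervalIntegrable_const
    (.of_forall fun θ _ => ?_)
  · rw [norm_mul, norm_mul, norm_div, norm_pow, norm_pow]
    simp only [norm_eq_abs, Nat.abs_cast]
    have h₁ : |cos θ| ^ n ≤ 1 := pow_le_one₀ (abs_nonneg _) (abs_cos_le_one θ)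
    have h₂ : |cos θ| ^ n * |cos (ν * θ)| ≤ 1 :=
      mul_le_one₀ h₁ (abs_nonneg _) (abs_cos_le_one _)
    exact mul_le_of_le_one_right (by positivity) h₂
  · have h := (NormedSpace.expSeries_div_hasSum_exp (w * cos θ)).mul_right (cos (ν * θ))
    rw [← exp_eq_exp_ℝ] at h
    refine h.congr_fun fun n => ?_
    rw [mul_pow]
    ring

theorem besselI_bounds (ν : ℕ) {w : ℝ} (hw : 0 ≤ w) :
    0 ≤ besselI ν w ∧ besselI ν w ≤ exp (2 * w) * (1 / 2) ^ ν := by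
  have h := hasSum_integral_exp_mul_cos ν w
  have hexp := (NormedSpace.expSeries_div_hasSum_exp (2 * w)).mul_left (π * (1 / 2) ^ ν)
  rw [← exp_eq_exp_ℝ] at hexp
  have hupper : (∫ θ in (0 : ℝ)..π, exp (w * cos θ) * cos (ν * θ)) ≤
      π * (1 / 2) ^ ν * exp (2 * w) := by
    refine hasSum_le (fun n => ?_) h hexp
    calc _ ≤ w ^ n / n.factorial * (π * 2 ^ n * (1 / 2) ^ ν) :=
          mul_le_mul_of_nonneg_left (integral_cos_pow_mul_cos_bounds n ν).2 (by positivity)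
      _ = _ := by rw [mul_pow]; ring
  have hlower : 0 ≤ (∫ θ in (0 : ℝ)..π, exp (w * cos θ) * cos (ν * θ)) :=
    h.nonneg fun n => mul_nonneg (by positivity) (integral_cos_pow_mul_cos_bounds n ν).1
  unfold besselI
  refine ⟨by positivity, ?_⟩
  rw [one_div_mul_eq_div, div_le_iff₀ pi_pos]
  linarith

theorem chebCoeff_eq_integral_cos (h : ℝ → ℝ) (m : ℕ) :
    chebCoeff h m = (2 / π) * ∫ θ in (0 : ℝ)..π, h (cos θ) * cos (m * θ) := by
  have := (Polynomial.Chebyshev.integral_measureT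
    (fun x => h x * (Polynomial.Chebyshev.T ℝ m).eval x)).symm.trans
    Polynomial.Chebyshev.integral_measureT_eq_integral_cos
  simp only [Polynomial.Chebyshev.T_real_cos, Int.cast_natCast] at this
  rw [chebCoeff, ← this]
  simp [div_eq_mul_inv]

theorem abs_chebCoeff_eq_abs_chebCoeff_comp_neg (h : ℝ → ℝ) (m : ℕ) :
    |chebCoeff h m| = |chebCoeff (fun x => h (-x)) m| := by
  have key : (∫ θ in (0 : ℝ)..π, h (cos θ) * cos (m * θ)) =
      (-1) ^ m * ∫ θ in (0 : ℝ)..π, h (-cos θ) * cos (m * θ) := by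
    have hrefl := intervalIntegral.integral_comp_sub_left
      (fun θ => h (cos θ) * cos (m * θ)) π (a := 0) (b := π)
    rw [sub_self, sub_zero] at hrefl
    rw [← hrefl, ← intervalIntegral.integral_const_mul]
    congr 1 with θ
    rw [cos_pi_sub, mul_sub, cos_nat_mul_pi_sub]
    ring
  rw [chebCoeff_eq_integral_cos, chebCoeff_eq_integral_cos, key]
  simp [abs_mul]

open Filter Topology MeasureTheory FourierTransform in
theorem tendsto_chebCoeff {h : ℝ → ℝ}
    (h_int : IntervalIntegrable (fun θ => h (cos θ)) volume 0 π) :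
    Tendsto (chebCoeff h) atTop (𝓝 0) := by
  have hRL := Real.tendsto_integral_exp_smul_cocompact
    ((Set.Ioc 0 π).indicator fun θ => ((h (cos θ) : ℝ) : ℂ))
  have hseq : Tendsto (fun m : ℕ => (m : ℝ) / (2 * π)) atTop (cocompact ℝ) :=
    (tendsto_natCast_atTop_atTop.atTop_div_const (by positivity)).mono_right atTop_le_cocompact
  have hre := (Complex.continuous_re.tendsto 0).comp (hRL.comp hseq)
  have hmain : Tendsto (fun m : ℕ => ∫ θ in (0 : ℝ)..π, h (cos θ) * cos (m * θ))
      atTop (𝓝 0) := by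
    refine hre.congr fun m => ?_
    have hind : Integrable ((Set.Ioc 0 π).indicator fun θ => ((h (cos θ) : ℝ) : ℂ)) := by
      rw [integrable_indicator_iff measurableSet_Ioc]
      exact ((intervalIntegrable_iff_integrableOn_Ioc_of_le pi_pos.le).mp h_int).ofReal
    have h_smul : Integrable fun v : ℝ => 𝐞 (-(v * ((m : ℝ) / (2 * π)))) •
        (Set.Ioc 0 π).indicator (fun θ => ((h (cos θ) : ℝ) : ℂ)) v := by
      simpa [mul_comm] using
        (Real.fourierIntegral_convergent_iff (μ := volume) ((m : ℝ) / (2 * π))).mpr hind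
    rw [intervalIntegral.integral_of_le pi_pos.le, ← integral_indicator measurableSet_Ioc]
    refine (integral_re h_smul).symm.trans (integral_congr_ae (.of_forall fun θ => ?_))
    by_cases hθ : θ ∈ Set.Ioc 0 π
    · have harg : 2 * π * -(θ * ((m : ℝ) / (2 * π))) = -(m * θ) := by field_simp
      simp only [Set.indicator_of_mem hθ, Circle.smul_def, Real.fourierChar_apply, harg,
        smul_eq_mul, RCLike.re_eq_complex_re, Complex.re_mul_ofReal,
        Complex.exp_ofReal_mul_I_re, cos_neg]
      ring
    · simp [hθ]
  have := hmain.const_mul (2 / π)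
  rw [mul_zero] at this
  exact this.congr fun m => (chebCoeff_eq_integral_cos h m).symm

/-- The function `x ↦ (1 − e^{−w}e^{wx})/(c(1−x))`, the reflection of `g` when `w = ct`. -/
noncomputable def reflectedKernel (c w x : ℝ) : ℝ :=
  (1 - exp (-w) * exp (w * x)) / (c * (1 - x))

theorem reflectedKernel_mul (c w x : ℝ) (hc : c ≠ 0) :
    reflectedKernel c w x * (1 - x) = (1 - exp (-w) * exp (w * x)) / c := by
  unfold reflectedKernel
  rcases eq_or_ne x 1 with rfl | hx
  · simp [← exp_add]
  · have : 1 - x ≠ 0 := sub_ne_zero.mpr hx.symm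
    field_simp

theorem abs_reflectedKernel_le {c w x : ℝ} (hc : 0 < c) (hw : 0 ≤ w) (hx : x ≤ 1) :
    |reflectedKernel c w x| ≤ w / c := by
  have h₁ : exp (-w) * exp (w * x) = exp (-(w * (1 - x))) := by rw [← exp_add]; ring_nf
  have h₂ : exp (-(w * (1 - x))) ≤ 1 := exp_le_one_iff.mpr (by nlinarith)
  have h₃ := add_one_le_exp (-(w * (1 - x)))
  unfold reflectedKernel
  rw [h₁, abs_of_nonneg (div_nonneg (by linarith) (mul_nonneg hc.le (by linarith)))]
  refine div_le_of_le_mul₀ (mul_nonneg hc.le (by linarith)) (by positivity) ?_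
  calc _ ≤ w * (1 - x) := by linarith
    _ = w / c * (c * (1 - x)) := by field_simp

theorem intervalIntegrable_reflectedKernel {c w : ℝ} (hc : 0 < c) (hw : 0 ≤ w) (m : ℕ) :
    IntervalIntegrable (fun θ => reflectedKernel c w (cos θ) * cos (m * θ))
      MeasureTheory.volume 0 π := by
  refine (intervalIntegrable_const (c := w / c)).mono_fun ?_ (.of_forall fun θ => ?_)
  · unfold reflectedKernel
    exact Measurable.aestronglyMeasurable (by fun_prop)
  · beta_reduce
    rw [norm_mul, norm_eq_abs, norm_eq_abs, norm_eq_abs, abs_of_nonneg (div_nonneg hw hc.le)]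
    exact (mul_le_of_le_one_right (abs_nonneg _) (abs_cos_le_one _)).trans
      (abs_reflectedKernel_le hc hw (cos_le_one θ))

theorem chebCoeff_reflectedKernel_second_difference {c w : ℝ} (hc : 0 < c) (hw : 0 ≤ w)
    (m : ℕ) :
    chebCoeff (reflectedKernel c w) m - 2 * chebCoeff (reflectedKernel c w) (m + 1) +
      chebCoeff (reflectedKernel c w) (m + 2) =
    4 * exp (-w) / c * besselI (m + 1) w := by
  have h_int := intervalIntegrable_reflectedKernel hc hw
  have hcos : (∫ θ in (0 : ℝ)..π, cos ((m + 1 : ℕ) * θ)) = 0 := by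
    have hm : ((m + 1 : ℕ) : ℝ) ≠ 0 := by positivity
    rw [intervalIntegral.integral_comp_mul_left (fun x => cos x) hm, integral_cos,
      sin_nat_mul_pi]
    simp
  have hpoint : (∫ θ in (0 : ℝ)..π, (reflectedKernel c w (cos θ) * cos (m * θ) -
      2 * (reflectedKernel c w (cos θ) * cos ((m + 1 : ℕ) * θ)) +
      reflectedKernel c w (cos θ) * cos ((m + 2 : ℕ) * θ))) =
      ∫ θ in (0 : ℝ)..π, (2 * exp (-w) / c * (exp (w * cos θ) * cos ((m + 1 : ℕ) * θ)) -
        2 / c * cos ((m + 1 : ℕ) * θ)) := by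
    congr 1 with θ
    have e₁ : ((m + 2 : ℕ) : ℝ) * θ = (m + 1 : ℕ) * θ + θ := by push_cast; ring
    have e₂ : (m : ℝ) * θ = (m + 1 : ℕ) * θ - θ := by push_cast; ring
    have e₃ := reflectedKernel_mul c w (cos θ) hc.ne'
    rw [e₁, e₂, cos_add, cos_sub]
    linear_combination (-2 * cos ((m + 1 : ℕ) * θ)) * e₃
  rw [intervalIntegral.integral_add ((h_int m).sub ((h_int (m + 1)).const_mul 2)) (h_int (m + 2)),
    intervalIntegral.integral_sub (h_int m) ((h_int (m + 1)).const_mul 2),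
    intervalIntegral.integral_sub (Continuous.intervalIntegrable (by fun_prop) _ _)
      (Continuous.intervalIntegrable (by fun_prop) _ _),
    intervalIntegral.integral_const_mul, intervalIntegral.integral_const_mul,
    intervalIntegral.integral_const_mul, hcos] at hpoint
  simp only [chebCoeff_eq_integral_cos, besselI]
  linear_combination 2 / π * hpoint

/-- Tail bound on the Chebyshev coefficients of `g(x) = (1 − e^{−ct}e^{−ctx})/(c(x+1))`:
`Σ_{m=k−1}^∞ |a_m[g]| ≤ (2e^{−ct}/c) Σ_{ν=k}^∞ (ν−k+2)(ν−k+1) I_ν(ct)`. -/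
theorem chebCoeff_tail_bound (c t : ℝ) (hc : 0 < c) (ht : 0 ≤ t) (k : ℕ) (hk : 2 ≤ k) :
    ∑' i : ℕ, |chebCoeff
        (fun x => (1 - Real.exp (-(c * t)) * Real.exp (-(c * t * x))) / (c * (x + 1)))
        (k - 1 + i)| ≤
      (2 * Real.exp (-(c * t)) / c) *
        ∑' i : ℕ, ((i : ℝ) + 2) * ((i : ℝ) + 1) * besselI (k + i) (c * t) := by
  have hw : 0 ≤ c * t := mul_nonneg hc.le ht
  set w := c * t
  set a := chebCoeff (reflectedKernel c w)
  obtain ⟨j, rfl⟩ : ∃ j, k = j + 1 := ⟨k - 1, by omega⟩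
  have ha : Filter.Tendsto a Filter.atTop (nhds 0) := tendsto_chebCoeff <| by
    simpa using intervalIntegrable_reflectedKernel hc hw 0
  have hsecond (m : ℕ) : a m - 2 * a (m + 1) + a (m + 2) =
      4 * exp (-w) / c * besselI (m + 1) w :=
    chebCoeff_reflectedKernel_second_difference hc hw m
  have hsecond_bounds (m : ℕ) : 0 ≤ a m - 2 * a (m + 1) + a (m + 2) ∧
      a m - 2 * a (m + 1) + a (m + 2) ≤ 4 * exp (-w) / c * exp (2 * w) * (1 / 2) ^ m := by
    obtain ⟨h₁, h₂⟩ := besselI_bounds (m + 1) hw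
    rw [hsecond, mul_assoc _ (exp (2 * w))]
    refine ⟨by positivity, mul_le_mul_of_nonneg_left (h₂.trans ?_) (by positivity)⟩
    have : 0 < exp (2 * w) * (1 / 2) ^ m := by positivity
    rw [pow_succ]
    linarith
  have hfirst_bounds := bounds_of_sub_succ_bounds (f := fun m => a m - a (m + 1))
    (by simpa using ha.sub (ha.comp (Filter.tendsto_add_atTop_nat 1)))
    (fun m => by
      have e : a m - a (m + 1) - (a (m + 1) - a (m + 2)) =
        a m - 2 * a (m + 1) + a (m + 2) := by ring
      exact e ▸ hsecond_bounds m)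
  have hbounds := bounds_of_sub_succ_bounds ha hfirst_bounds
  have hshift {x C : ℝ} (i : ℕ) (h : 0 ≤ x ∧ x ≤ C * (1 / 2) ^ (j + i)) :
      0 ≤ x ∧ x ≤ C * (1 / 2) ^ j * (1 / 2) ^ i := by rwa [mul_assoc, ← pow_add]
  have hsum := tsum_weighted_second_difference (u := fun i => a (j + i))
    (fun i => hshift i (hbounds (j + i))) (fun i => hshift i (hsecond_bounds (j + i)))
  have hleft : (∑' i : ℕ, |chebCoeff
      (fun x => (1 - exp (-w) * exp (-(w * x))) / (c * (x + 1))) (j + 1 - 1 + i)|) =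
      ∑' i : ℕ, a (j + i) := by
    congr 1 with i
    rw [abs_chebCoeff_eq_abs_chebCoeff_comp_neg, ← abs_of_nonneg (hbounds (j + i)).1,
      Nat.add_sub_cancel]
    congr 2 with x
    unfold reflectedKernel
    rw [mul_neg, neg_neg, neg_add_eq_sub]
  have hright : (∑' i : ℕ, ((i : ℝ) + 2) * ((i : ℝ) + 1) *
      (a (j + i) - 2 * a (j + (i + 1)) + a (j + (i + 2)))) =
      4 * exp (-w) / c * ∑' i : ℕ, ((i : ℝ) + 2) * ((i : ℝ) + 1) * besselI (j + 1 + i) w := by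
    rw [← tsum_mul_left]
    congr 1 with i
    rw [← add_assoc, ← add_assoc, hsecond, add_right_comm j i 1]
    ring
  rw [hleft]
  linear_combination (1 / 2) * hright - (1 / 2) * hsum
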